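/- Every (n-D)-connected graph G on n vertices has a general position orthogonal representation in R^D. -/

import Mathlib

open scoped RealInnerProductSpace

/-- A graph is `k`-connected: more than `k` vertices, and deleting any set of
fewer than `k` vertices leaves a connected graph. -/
def IsKConnected {n : ℕ} (G : SimpleGraph (Fin n)) (k : ℕ) : Prop :=
  k < n ∧ ∀ S : Finset (Fin n), S.card < k →
    (G.induce ((↑S : Set (Fin n))ᶜ)).Connected

namespace OrthRep

open Matrix Function
open scoped ContDiff

section Analytic

variable {E : Type*} [NormedAddCommGroup E] [NormedSpace ℝ E]

/-- Real analytic functions on a normed space have no zero divisors. -/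
theorem eq_zero_of_mul_eq_zero {f g : E → ℝ} (hf : ContDiff ℝ ω f) (hg : ContDiff ℝ ω g)
    (hfg : ∀ x, f x * g x = 0) (hg0 : ∃ x, g x ≠ 0) (x : E) : f x = 0 := by
  obtain ⟨a, ha⟩ := hg0
  have hev : f =ᶠ[nhds a] 0 := by
    filter_upwards [hg.continuous.continuousAt.eventually_ne ha] with y hy
    exact (mul_eq_zero.mp (hfg y)).resolve_right hy
  exact (contDiff_omega_iff_analyticOnNhd.mp hf).eqOn_zero_of_preconnected_of_eventuallyEq_zero
    isPreconnected_univ (Set.mem_univ a) hev (Set.mem_univ x)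

/-- Finitely many nonzero real analytic functions have a common point of nonvanishing. -/
theorem exists_forall_ne_zero {ι : Type*} (s : Finset ι) (f : ι → E → ℝ)
    (hf : ∀ i ∈ s, ContDiff ℝ ω (f i)) (h0 : ∀ i ∈ s, ∃ x, f i x ≠ 0) :
    ∃ x, ∀ i ∈ s, f i x ≠ 0 := by
  classical
  induction s using Finset.induction_on with
  | empty => exact ⟨0, by simp⟩
  | insert a s ha ih =>
    simp only [Finset.forall_mem_insert] at hf h0 ⊢
    obtain ⟨x, hx⟩ := ih hf.2 h0.2
    by_contra! hcon
    obtain ⟨y, hy⟩ := h0.1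
    refine hy (eq_zero_of_mul_eq_zero hf.1 (contDiff_prod hf.2) (fun z => ?_)
      ⟨x, Finset.prod_ne_zero_iff.mpr hx⟩ y)
    by_cases hz : f a z = 0
    · rw [hz, zero_mul]
    · obtain ⟨i, hi, hi0⟩ := hcon z hz
      rw [Finset.prod_eq_zero hi hi0, mul_zero]

theorem contDiff_det {ι : Type*} [Fintype ι] [DecidableEq ι] {A : E → Matrix ι ι ℝ}
    (hA : ∀ i j, ContDiff ℝ ω (fun x => A x i j)) : ContDiff ℝ ω (fun x => (A x).det) := by
  simp only [det_apply']
  exact ContDiff.sum fun σ _ => contDiff_const.mul (contDiff_prod fun i _ => hA _ _)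

theorem contDiff_adjugate {ι : Type*} [Fintype ι] [DecidableEq ι] {A : E → Matrix ι ι ℝ}
    (hA : ∀ i j, ContDiff ℝ ω (fun x => A x i j)) (i j : ι) :
    ContDiff ℝ ω (fun x => (A x).adjugate i j) := by
  simp only [adjugate_apply]
  refine contDiff_det fun k m => ?_
  by_cases hk : k = j
  · subst hk
    simpa using contDiff_const
  · simpa [updateRow_ne hk] using hA k m

end Analytic

variable {V : Type*} {F : Type*} [NormedAddCommGroup F] [InnerProductSpace ℝ F]

section GramProj

variable [DecidableEq V]

/-- The determinant of the Gram matrix of the vectors `v i` with `i ∈ N`. -/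
noncomputable def gramDet (N : Finset V) (v : V → F) : ℝ :=
  (gram ℝ (fun i : N => v i)).det

theorem gramDet_ne_zero_iff {N : Finset V} {v : V → F} :
    gramDet N v ≠ 0 ↔ LinearIndependent ℝ (fun i : N => v i) :=
  det_gram_ne_zero_iff_linearIndependent

/-- The orthogonal projection of `x` to the complement of the vectors `v i` with `i ∈ N`, scaled by
their Gram determinant so that it depends polynomially on `v`. -/
noncomputable def gramProj (N : Finset V) (v : V → F) (x : F) : F :=
  gramDet N v • x -
    ∑ i : N, ((gram ℝ (fun i : N => v i)).adjugate *ᵥ fun j : N => ⟪v j, x⟫) i • v i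

theorem inner_gramProj {N : Finset V} {v : V → F} (x : F) {k : V} (hk : k ∈ N) :
    ⟪v k, gramProj N v x⟫ = 0 := by
  set A := gram ℝ (fun i : N => v i) with hA
  set b : N → ℝ := fun j => ⟪v j, x⟫ with hb
  have h : (A *ᵥ (A.adjugate *ᵥ b)) ⟨k, hk⟩ = A.det * b ⟨k, hk⟩ := by
    rw [mulVec_mulVec, mul_adjugate, smul_mulVec, one_mulVec, Pi.smul_apply, smul_eq_mul]
  have h' : (A *ᵥ (A.adjugate *ᵥ b)) ⟨k, hk⟩ = ∑ i : N, (A.adjugate *ᵥ b) i * ⟪v k, v i⟫ := by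
    rw [mulVec, dotProduct]
    exact Finset.sum_congr rfl fun i _ => mul_comm _ _
  rw [gramProj, inner_sub_right, inner_sum, inner_smul_right, gramDet, ← hA, ← hb]
  simp only [inner_smul_right]
  rw [← h', h, sub_self]

theorem gramProj_inv_smul {N : Finset V} {v : V → F} (hN : gramDet N v ≠ 0) {x : F}
    (hx : ∀ k ∈ N, ⟪v k, x⟫ = 0) : gramProj N v ((gramDet N v)⁻¹ • x) = x := by
  have h : (fun j : N => ⟪v j, (gramDet N v)⁻¹ • x⟫) = 0 := by
    funext j
    simp [inner_smul_right, hx j j.2]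
  rw [gramProj, h, smul_inv_smul₀ hN]
  simp

theorem gramProj_congr {N : Finset V} {v v' : V → F} (h : ∀ k ∈ N, v k = v' k) (x : F) :
    gramProj N v x = gramProj N v' x := by
  have h' : (fun i : N => v i) = fun i : N => v' i := funext fun i => h i i.2
  have h'' : ∀ i : N, v i = v' i := fun i => h i i.2
  simp only [gramProj, gramDet, h']
  simp only [h'']

theorem gramProj_update {N : Finset V} {w : V} (hw : w ∉ N) (v : V → F) (y x : F) :
    gramProj N (update v w y) x = gramProj N v x :=
  gramProj_congr (fun _ hk => update_of_ne (ne_of_mem_of_not_mem hk hw) _ _) x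

variable [Fintype V]

omit [DecidableEq V] in
theorem contDiff_gram (N : Finset V) (i j : N) :
    ContDiff ℝ ω (fun v : V → F => gram ℝ (fun i : N => v i) i j) := by
  simp only [gram_apply]
  exact (contDiff_apply ℝ F (i : V)).inner ℝ (contDiff_apply ℝ F (j : V))

theorem contDiff_gramDet (N : Finset V) : ContDiff ℝ ω (gramDet N : (V → F) → ℝ) :=
  contDiff_det (contDiff_gram N)

theorem _root_.ContDiff.gramProj {E : Type*} [NormedAddCommGroup E] [NormedSpace ℝ E]
    (N : Finset V) {v : E → V → F} {x : E → F} (hv : ContDiff ℝ ω v) (hx : ContDiff ℝ ω x) :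
    ContDiff ℝ ω (fun e => gramProj N (v e) (x e)) := by
  have hv' (i : V) : ContDiff ℝ ω (fun e => v e i) := contDiff_pi.mp hv i
  refine (((contDiff_gramDet N).comp hv).smul hx).sub (ContDiff.sum fun i _ => ?_)
  refine ContDiff.smul ?_ (hv' i)
  simp only [mulVec, dotProduct]
  exact ContDiff.sum fun j _ => (contDiff_adjugate
    (fun a b => (contDiff_gram N a b).comp hv) i j).mul ((hv' j).inner ℝ hx)

theorem _root_.ContDiff.fun_update {E : Type*} [NormedAddCommGroup E] [NormedSpace ℝ E]
    {v : E → V → F} {x : E → F} (hv : ContDiff ℝ ω v) (w : V) (hx : ContDiff ℝ ω x) :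
    ContDiff ℝ ω (fun e => update (v e) w (x e)) := by
  refine contDiff_pi.mpr fun i => ?_
  by_cases hi : i = w
  · subst hi
    simpa using hx
  · simpa [hi] using contDiff_pi.mp hv i

end GramProj

section SeqRep

variable [DecidableEq V] (G : SimpleGraph V)

open Classical in
/-- The members of `l` that are not adjacent to `w`. -/
noncomputable def nonNbrs (l : List V) (w : V) : Finset V :=
  l.toFinset.filter fun j => ¬ G.Adj w j

variable {G} in
theorem mem_nonNbrs {l : List V} {w j : V} : j ∈ nonNbrs G l w ↔ j ∈ l ∧ ¬ G.Adj w j := by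
  simp [nonNbrs]

/-- Sequential construction of an orthogonal representation: the vertices of the list are treated
from last to first, each vector being the scaled projection of the parameter `z w` to the orthogonal
complement of the vectors of the nonadjacent vertices treated before. -/
noncomputable def seqRep : List V → (V → F) → V → F
  | [], z => z
  | w :: l, z => update (seqRep l z) w (gramProj (nonNbrs G l w) (seqRep l z) (z w))

variable {G}

theorem seqRep_update {l : List V} {w : V} (hw : w ∉ l) (z : V → F) (x : F) :
    seqRep G l (update z w x) = update (seqRep G l z) w x := by
  induction l with
  | nil => rfl
  | cons u l ih =>
    simp only [List.mem_cons, not_or] at hw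
    have hN : w ∉ nonNbrs G l u := fun h => hw.2 (mem_nonNbrs.mp h).1
    rw [seqRep, seqRep, ih hw.2, gramProj_update hN, update_of_ne (Ne.symm hw.1),
      update_comm hw.1]

theorem inner_seqRep {l : List V} (hl : l.Nodup) (z : V → F) {i j : V} (hi : i ∈ l) (hj : j ∈ l)
    (hij : i ≠ j) (hG : ¬ G.Adj i j) : ⟪seqRep G l z i, seqRep G l z j⟫ = 0 := by
  induction l with
  | nil => simp at hi
  | cons w l ih =>
    have hw := (List.nodup_cons.mp hl).1
    have key : ∀ k ∈ l, ¬ G.Adj w k →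
        ⟪seqRep G l z k, gramProj (nonNbrs G l w) (seqRep G l z) (z w)⟫ = 0 :=
      fun k hk hwk => inner_gramProj _ (mem_nonNbrs.mpr ⟨hk, hwk⟩)
    rw [seqRep]
    rcases List.mem_cons.mp hi with rfl | hil
    · have hj := (List.mem_cons.mp hj).resolve_left (Ne.symm hij)
      rw [update_self, update_of_ne (Ne.symm hij), real_inner_comm]
      exact key j hj hG
    · rw [update_of_ne (ne_of_mem_of_not_mem hil hw)]
      rcases List.mem_cons.mp hj with rfl | hjl
      · rw [update_self]
        exact key i hil fun h => hG h.symm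
      · rw [update_of_ne (ne_of_mem_of_not_mem hjl hw)]
        exact ih hl.of_cons hil hjl

/-- Every linearly independent orthogonal representation arises from the sequential
construction. -/
theorem exists_seqRep_eq {l : List V} (hl : l.Nodup) {v : V → F}
    (hv : ∀ i ∈ l, ∀ j ∈ l, i ≠ j → ¬ G.Adj i j → ⟪v i, v j⟫ = 0)
    (hli : LinearIndependent ℝ (fun i : l.toFinset => v i)) : ∃ z, seqRep G l z = v := by
  induction l with
  | nil => exact ⟨v, rfl⟩
  | cons w l ih =>
    have hw := (List.nodup_cons.mp hl).1
    have hsub : ∀ N : Finset V, N ⊆ (w :: l).toFinset →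
        LinearIndependent ℝ (fun i : N => v i) := fun N hN =>
      hli.comp (fun i : N => ⟨i, hN i.2⟩) fun a b hab => Subtype.ext (congrArg (·.1) hab)
    obtain ⟨z, hz⟩ := ih hl.of_cons
      (fun i hi j hj => hv i (List.mem_cons_of_mem _ hi) j (List.mem_cons_of_mem _ hj))
      (hsub _ fun i hi => by simp_all)
    set N := nonNbrs G l w
    have hwN : w ∉ N := fun h => hw (mem_nonNbrs.mp h).1
    have hN : gramDet N v ≠ 0 := gramDet_ne_zero_iff.mpr
      (hsub N fun i hi => by simp [(mem_nonNbrs.mp hi).1])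
    refine ⟨update z w ((gramDet N v)⁻¹ • v w), ?_⟩
    rw [seqRep, seqRep_update hw, update_idem, update_self, hz, gramProj_update hwN,
      gramProj_inv_smul hN, update_eq_self]
    intro k hk
    have hk' := mem_nonNbrs.mp hk
    exact hv k (List.mem_cons_of_mem _ hk'.1) w List.mem_cons_self
      (ne_of_mem_of_not_mem hk hwN) fun h => hk'.2 h.symm

theorem seqRep_swap {l : List V} {u w : V} (hu : u ∉ l) (hw : w ∉ l) (huw : G.Adj u w)
    (z : V → F) : seqRep G (u :: w :: l) z = seqRep G (w :: u :: l) z := by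
  have hcons : ∀ {a b : V}, G.Adj a b → nonNbrs G (b :: l) a = nonNbrs G l a := by
    intro a b hab
    ext j
    simp only [mem_nonNbrs, List.mem_cons]
    constructor
    · rintro ⟨rfl | hj, h⟩
      · exact absurd hab h
      · exact ⟨hj, h⟩
    · exact fun h => ⟨Or.inr h.1, h.2⟩
  have hwN : w ∉ nonNbrs G l u := fun h => hw (mem_nonNbrs.mp h).1
  have huN : u ∉ nonNbrs G l w := fun h => hu (mem_nonNbrs.mp h).1
  simp only [seqRep, hcons huw, hcons huw.symm, gramProj_update hwN, gramProj_update huN]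
  exact update_comm huw.ne.symm _ _ _

theorem seqRep_append_apply {l₁ l₂ : List V} {i : V} (hi : i ∉ l₁) (z : V → F) :
    seqRep G (l₁ ++ l₂) z i = seqRep G l₂ z i := by
  induction l₁ with
  | nil => rfl
  | cons w l ih =>
    simp only [List.mem_cons, not_or] at hi
    rw [List.cons_append, seqRep, update_of_ne hi.1, ih hi.2]

variable [Fintype V]

theorem contDiff_seqRep (l : List V) : ContDiff ℝ ω (seqRep G l : (V → F) → V → F) := by
  induction l with
  | nil => exact contDiff_id
  | cons w l ih => exact ih.fun_update w (ih.gramProj _ (contDiff_apply ℝ F w))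

variable (F G) in
/-- Every analytic function vanishing on the representations constructed along `l` vanishes on
those constructed along `l'`. -/
def VanishLE (l l' : List V) : Prop :=
  ∀ f : (V → F) → ℝ, ContDiff ℝ ω f → (∀ z, f (seqRep G l z) = 0) → ∀ z, f (seqRep G l' z) = 0

theorem VanishLE.trans {l₁ l₂ l₃ : List V} (h : VanishLE F G l₁ l₂) (h' : VanishLE F G l₂ l₃) :
    VanishLE F G l₁ l₃ :=
  fun f hf h0 => h' f hf (h f hf h0)

theorem VanishLE.cons {l l' : List V} {w : V} (hw : w ∉ l) (hp : l.Perm l')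
    (h : VanishLE F G l l') : VanishLE F G (w :: l) (w :: l') := by
  intro f hf h0 z
  have hN : nonNbrs G l' w = nonNbrs G l w := by
    ext j
    simp only [mem_nonNbrs, hp.mem_iff]
  have hwN : w ∉ nonNbrs G l w := fun h => hw (mem_nonNbrs.mp h).1
  have := h (fun v => f (update v w (gramProj (nonNbrs G l w) v (z w))))
    (hf.comp (contDiff_id.fun_update w (contDiff_id.gramProj _ contDiff_const))) (fun z' => ?_) z
  · rw [seqRep, hN]
    exact this
  · have h1 := h0 (update z' w (z w))
    rwa [seqRep, seqRep_update hw, update_idem, update_self, gramProj_update hwN] at h1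

omit [Fintype V] in
theorem exists_gramDet_seqRep_ne_zero [FiniteDimensional ℝ F] {l : List V} (hl : l.Nodup)
    (hlen : l.length ≤ Module.finrank ℝ F) :
    ∃ z : V → F, gramDet l.toFinset (seqRep G l z) ≠ 0 := by
  obtain ⟨e⟩ : Nonempty (l.toFinset ↪ Fin (Module.finrank ℝ F)) := by
    apply Function.Embedding.nonempty_of_card_le
    rwa [Fintype.card_coe, Fintype.card_fin, List.toFinset_card_of_nodup hl]
  let v : V → F := fun i => if h : i ∈ l.toFinset then stdOrthonormalBasis ℝ F (e ⟨i, h⟩) else 0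
  have hv : (fun i : l.toFinset => v i) = stdOrthonormalBasis ℝ F ∘ e := by
    funext i
    exact dif_pos i.2
  have ho : Orthonormal ℝ (fun i : l.toFinset => v i) := by
    rw [hv]
    exact (stdOrthonormalBasis ℝ F).orthonormal.comp e e.injective
  obtain ⟨z, hz⟩ := exists_seqRep_eq (G := G) hl
    (fun i hi j hj hij _ => ho.2 (i := ⟨i, List.mem_toFinset.mpr hi⟩)
      (j := ⟨j, List.mem_toFinset.mpr hj⟩) fun h => hij (congrArg (·.1) h)) ho.linearIndependent
  exact ⟨z, hz ▸ gramDet_ne_zero_iff.mpr ho.linearIndependent⟩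

theorem vanishLE_of_length_le [FiniteDimensional ℝ F] {l l' : List V} (hl : l.Nodup)
    (hp : l.Perm l') (hlen : l.length ≤ Module.finrank ℝ F) : VanishLE F G l l' := by
  intro f hf h0 z
  have hl' := hp.nodup_iff.mp hl
  refine eq_zero_of_mul_eq_zero (hf.comp (contDiff_seqRep l'))
    ((contDiff_gramDet l'.toFinset).comp (contDiff_seqRep l')) (fun x => ?_)
    (exists_gramDet_seqRep_ne_zero (G := G) hl' (hp.length_eq ▸ hlen)) z
  by_cases hx : gramDet l'.toFinset (seqRep G l' x) = 0
  · exact mul_eq_zero_of_right _ hx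
  · refine mul_eq_zero_of_left ?_ _
    obtain ⟨y, hy⟩ := exists_seqRep_eq (G := G) (v := seqRep G l' x) hl
      (fun i hi j hj => inner_seqRep hl' x (hp.mem_iff.mp hi) (hp.mem_iff.mp hj))
      (List.toFinset_eq_of_perm _ _ hp ▸ gramDet_ne_zero_iff.mp hx)
    exact (congrArg f hy).symm.trans (h0 y)

/-- If every set of more than `dim F` vertices induces a connected subgraph, then the analytic
functions vanishing on the constructed representations do not depend on the order of the
vertices. -/
theorem vanishLE_of_perm [FiniteDimensional ℝ F]
    (hG : ∀ s : Finset V, Module.finrank ℝ F < s.card → (G.induce (s : Set V)).Connected)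
    {l l' : List V} (hl : l.Nodup) (hp : l.Perm l') : VanishLE F G l l' := by
  induction hm : l.length generalizing l l' with
  | zero =>
    exact vanishLE_of_length_le hl hp (by omega)
  | succ m ih =>
    by_cases hlen : l.length ≤ Module.finrank ℝ F
    · exact vanishLE_of_length_le hl hp hlen
    have hconn := hG l.toFinset (by rw [List.toFinset_card_of_nodup hl]; omega)
    have hsame : ∀ (w : V) (k k' : List V), l.Perm (w :: k) → l.Perm (w :: k') →
        VanishLE F G (w :: k) (w :: k') := by
      intro w k k' hk hk'
      have hnd := List.nodup_cons.mp (hk.nodup_iff.mp hl)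
      have hkk : k.Perm k' := (List.perm_cons w).mp (hk.symm.trans hk')
      refine VanishLE.cons hnd.1 hkk (ih hnd.2 hkk ?_)
      have := hk.length_eq
      simp only [List.length_cons] at this
      omega
    have hwalk : ∀ a b : (l.toFinset : Set V), (G.induce (l.toFinset : Set V)).Walk a b →
        ∀ k k' : List V, l.Perm ((a : V) :: k) → l.Perm ((b : V) :: k') →
          VanishLE F G ((a : V) :: k) ((b : V) :: k') := by
      intro a b p
      induction p with
      | nil => exact fun k k' => hsame _ k k'
      | @cons a c b hac p ihp =>
        intro k k' hk hk'
        have hadj : G.Adj a c := hac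
        have hck : (c : V) ∈ k := by
          have : (c : V) ∈ l := by simpa using c.2
          exact (List.mem_cons.mp (hk.mem_iff.mp this)).resolve_left hadj.ne.symm
        have h1 : l.Perm (a :: c :: k.erase c) :=
          hk.trans ((List.perm_cons_erase hck).cons _)
        have h2 : l.Perm (c :: a :: k.erase c) := h1.trans (List.Perm.swap _ _ _)
        have hnd := h1.nodup_iff.mp hl
        simp only [List.nodup_cons, List.mem_cons, not_or] at hnd
        refine (hsame a k (c :: k.erase c) hk h1).trans
          (VanishLE.trans ?_ (ihp (a :: k.erase c) k' h2 hk'))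
        intro f _ h0 z
        rw [← seqRep_swap hnd.1.2 hnd.2.1 hadj]
        exact h0 z
    match l, l', hp, hm with
    | a :: k, [], hp, _ => exact absurd hp.length_eq (by simp)
    | a :: k, b :: k', hp, _ =>
      obtain ⟨p⟩ := hconn.preconnected ⟨a, by simp⟩ ⟨b, by simpa using hp.mem_iff.mpr (by simp)⟩
      exact hwalk _ _ p k k' (List.Perm.refl _) hp

/-- A graph in which every set of more than `dim F` vertices induces a connected subgraph has a
general position orthogonal representation in `F`. -/
theorem exists_gor [FiniteDimensional ℝ F]
    (hG : ∀ s : Finset V, Module.finrank ℝ F < s.card → (G.induce (s : Set V)).Connected) :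
    ∃ v : V → F, (∀ i j, i ≠ j → ¬ G.Adj i j → ⟪v i, v j⟫ = 0) ∧
      ∀ s : Finset V, s.card = Module.finrank ℝ F → LinearIndependent ℝ (fun i : s => v i) := by
  let l := (Finset.univ : Finset V).toList
  have hnd : l.Nodup := Finset.nodup_toList _
  have hmem : ∀ i, i ∈ l := fun i => by simp [l]
  have hgen : ∀ s : Finset V, s.card = Module.finrank ℝ F →
      ∃ z : V → F, gramDet s (seqRep G l z) ≠ 0 := by
    intro s hs
    by_contra! hcon
    have hp : l.Perm (sᶜ.toList ++ s.toList) := by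
      rw [List.perm_ext_iff_of_nodup hnd]
      · intro a
        simp [hmem, or_comm, em]
      · refine List.Nodup.append (Finset.nodup_toList _) (Finset.nodup_toList _) ?_
        intro a ha ha'
        simp_all
    have h0 := vanishLE_of_perm hG hnd hp _ (contDiff_gramDet s) hcon
    obtain ⟨x, hx⟩ := exists_gramDet_seqRep_ne_zero (F := F) (G := G) s.nodup_toList
      (by simp [hs])
    rw [Finset.toList_toFinset] at hx
    refine hx (Eq.trans ?_ (h0 x))
    have : (fun i : s => seqRep G (sᶜ.toList ++ s.toList) x i) =
        fun i : s => seqRep G s.toList x i := funext fun i => seqRep_append_apply (by simp) x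
    rw [gramDet, gramDet, this]
  obtain ⟨z, hz⟩ := exists_forall_ne_zero
    (Finset.univ.filter fun s : Finset V => s.card = Module.finrank ℝ F)
    (fun s (z : V → F) => gramDet s (seqRep G l z))
    (fun s _ => (contDiff_gramDet s).comp (contDiff_seqRep l))
    (fun s hs => hgen s (by simpa using hs))
  exact ⟨seqRep G l z, fun i j => inner_seqRep hnd z (hmem i) (hmem j),
    fun s hs => gramDet_ne_zero_iff.mp (hz s (by simpa using hs))⟩

end SeqRep

end OrthRep

/-- every `(n-D)`-connected graph on `n` vertices has a general
position orthogonal representation in `ℝ^D`. -/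
theorem stmt1 {n D : ℕ} (G : SimpleGraph (Fin n))
    (hcon : IsKConnected G (n - D)) :
    ∃ v : Fin n → EuclideanSpace ℝ (Fin D),
      (∀ i j : Fin n, i ≠ j → ¬ G.Adj i j → ⟪v i, v j⟫ = 0) ∧
      (∀ s : Finset (Fin n), s.card = D →
        LinearIndependent ℝ (fun i : s => v i)) := by
  obtain ⟨v, hv, hli⟩ := OrthRep.exists_gor (F := EuclideanSpace ℝ (Fin D)) (G := G) fun s hs => by
    rw [finrank_euclideanSpace_fin] at hs
    have hn := s.card_le_univ
    rw [Fintype.card_fin] at hn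
    have h := hcon.2 sᶜ (by rw [Finset.card_compl, Fintype.card_fin]; omega)
    rwa [Finset.coe_compl, compl_compl] at h
  exact ⟨v, hv, fun s hs => hli s (by rw [hs, finrank_euclideanSpace_fin])⟩
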